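/- Mehler's formula: for |a| < 1 and the bivariate normal density p(w,w') of a pair with standard normal marginals and correlation a, one has p(w,w') = φ(w)φ(w') Σ_{n=0}^∞ (a^n / n!) He_n(w) He_n(w'), where φ is the standard normal density and He_n are the probabilist's Hermite polynomials. -/

import Mathlib

open MeasureTheory

/-- The standard normal density. -/
noncomputable def stdNormalPDF (w : ℝ) : ℝ :=
  (Real.sqrt (2 * Real.pi))⁻¹ * Real.exp (-(w ^ 2) / 2)

/-- The bivariate normal density with standard normal marginals and correlation `a`. -/
noncomputable def bivNormalPDF (a w w' : ℝ) : ℝ :=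
  (2 * Real.pi * Real.sqrt (1 - a ^ 2))⁻¹ *
    Real.exp (-(w ^ 2 - 2 * a * w * w' + w' ^ 2) / (2 * (1 - a ^ 2)))

section HermiteIntegral

open Polynomial

theorem derivative_hermite_succ (n : ℕ) :
    derivative (hermite (n + 1)) = ((n + 1 : ℕ) : ℤ[X]) * hermite n := by
  induction n with
  | zero => simp
  | succ n ih =>
    rw [hermite_succ (n + 1), derivative_sub, derivative_mul, ih, derivative_mul,
      derivative_natCast, derivative_X, hermite_succ n]
    push_cast
    ring

/-- The three-term recurrence of the probabilist's Hermite polynomials. -/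
theorem hermite_add_two (n : ℕ) :
    hermite (n + 2) = X * hermite (n + 1) - ((n + 1 : ℕ) : ℤ[X]) * hermite n := by
  rw [hermite_succ (n + 1), derivative_hermite_succ]

theorem norm_cexp_neg_sq_div_two (y : ℝ) :
    ‖Complex.exp (-(y : ℂ) ^ 2 / 2)‖ = Real.exp (-y ^ 2 / 2) := by
  rw [← Complex.norm_of_nonneg (Real.exp_pos _).le]
  push_cast
  rfl

theorem norm_ofReal_add_mul_I_le (x y : ℝ) :
    ‖(x : ℂ) + y * Complex.I‖ ≤ |x| + |y| := by
  simpa using norm_add_le (x : ℂ) (y * Complex.I)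

theorem integrable_pow_mul_gaussian (n : ℕ) (x : ℝ) :
    Integrable fun y : ℝ =>
      ((x : ℂ) + y * Complex.I) ^ n * Complex.exp (-(y : ℂ) ^ 2 / 2) := by
  refine ((integrable_exp_neg_mul_sq (b := 1 / 4) (by norm_num)).const_mul
    (n.factorial * Real.exp (|x| + 1))).mono' (by fun_prop) (.of_forall fun y => ?_)
  rw [norm_mul, norm_pow, norm_cexp_neg_sq_div_two]
  have h1 : ‖(x : ℂ) + y * Complex.I‖ ^ n ≤ n.factorial * Real.exp (|x| + |y|) := by
    refine (pow_le_pow_left₀ (norm_nonneg _) (norm_ofReal_add_mul_I_le x y) n).trans ?_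
    have := Real.pow_div_factorial_le_exp (x := |x| + |y|) (by positivity) n
    rwa [div_le_iff₀' (by positivity)] at this
  calc _ ≤ n.factorial * Real.exp (|x| + |y|) * Real.exp (-y ^ 2 / 2) := by gcongr
    _ = n.factorial * Real.exp (|x| + |y| + -y ^ 2 / 2) := by rw [mul_assoc, ← Real.exp_add]
    _ ≤ n.factorial * Real.exp (|x| + 1 + -(1 / 4) * y ^ 2) := by
      gcongr ?_ * Real.exp ?_
      nlinarith [sq_nonneg (|y| - 2), sq_abs y]
    _ = _ := by rw [Real.exp_add _ (-(1 / 4) * y ^ 2), mul_assoc]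

theorem integral_pow_mul_gaussian_add_two (n : ℕ) (x : ℝ) :
    ∫ y : ℝ, ((x : ℂ) + y * Complex.I) ^ (n + 2) * Complex.exp (-(y : ℂ) ^ 2 / 2) =
      x * (∫ y : ℝ, ((x : ℂ) + y * Complex.I) ^ (n + 1) * Complex.exp (-(y : ℂ) ^ 2 / 2)) -
      (n + 1) * ∫ y : ℝ, ((x : ℂ) + y * Complex.I) ^ n * Complex.exp (-(y : ℂ) ^ 2 / 2) := by
  have hI := fun m => integrable_pow_mul_gaussian m x
  have hd : ∀ y : ℝ, HasDerivAt
      (fun y : ℝ => -Complex.I *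
        (((x : ℂ) + y * Complex.I) ^ (n + 1) * Complex.exp (-(y : ℂ) ^ 2 / 2)))
      (((x : ℂ) + y * Complex.I) ^ (n + 2) * Complex.exp (-(y : ℂ) ^ 2 / 2) -
        x * (((x : ℂ) + y * Complex.I) ^ (n + 1) * Complex.exp (-(y : ℂ) ^ 2 / 2)) +
        (n + 1) * (((x : ℂ) + y * Complex.I) ^ n * Complex.exp (-(y : ℂ) ^ 2 / 2))) y := by
    intro y
    have h0 : HasDerivAt (fun y : ℝ => (y : ℂ)) 1 y := Complex.ofRealCLM.hasDerivAt
    have h1 := ((h0.mul_const Complex.I).const_add (x : ℂ)).pow (n + 1)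
    have h2 := ((h0.pow 2).neg.div_const 2).cexp
    refine ((h1.mul h2).const_mul (-Complex.I)).congr_deriv ?_
    simp only [Pi.pow_apply, Pi.neg_apply, add_tsub_cancel_right]
    push_cast
    linear_combination (-(n + 1 : ℂ) * (x + y * Complex.I) ^ n *
      Complex.exp (-(y : ℂ) ^ 2 / 2)) * Complex.I_sq
  have h := integral_eq_zero_of_hasDerivAt_of_integrable hd
    (((hI (n + 2)).sub ((hI (n + 1)).const_mul _)).add ((hI n).const_mul _))
    ((hI (n + 1)).const_mul _)
  rw [integral_add (by exact (hI (n + 2)).sub ((hI (n + 1)).const_mul _)) ((hI n).const_mul _),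
    integral_sub (hI (n + 2)) ((hI (n + 1)).const_mul _), integral_const_mul,
    integral_const_mul] at h
  linear_combination h

theorem integral_cexp_neg_sq_div_two :
    ∫ y : ℝ, Complex.exp (-(y : ℂ) ^ 2 / 2) = (Real.sqrt (2 * Real.pi) : ℂ) := by
  have h := integral_gaussian (1 / 2)
  rw [show Real.pi / (1 / 2) = 2 * Real.pi by ring] at h
  rw [← h, ← integral_complex_ofReal]
  congr 1 with y
  push_cast
  ring_nf

/-- Hermite polynomials as Gaussian moments: `√(2π) Heₙ(x) = ∫ (x + iy)ⁿ exp(-y²/2) dy`. -/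
theorem integral_pow_mul_gaussian (n : ℕ) (x : ℝ) :
    ∫ y : ℝ, ((x : ℂ) + y * Complex.I) ^ n * Complex.exp (-(y : ℂ) ^ 2 / 2) =
      (Real.sqrt (2 * Real.pi) : ℂ) * ((aeval x (hermite n) : ℝ) : ℂ) := by
  induction n using Nat.twoStepInduction with
  | zero => simp [integral_cexp_neg_sq_div_two]
  | one =>
    have hg : Integrable fun y : ℝ => Complex.exp (-(y : ℂ) ^ 2 / 2) := by
      simpa using integrable_pow_mul_gaussian 0 0
    have hyg : Integrable fun y : ℝ => (y : ℂ) * Complex.I * Complex.exp (-(y : ℂ) ^ 2 / 2) := by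
      simpa using integrable_pow_mul_gaussian 1 0
    have hodd : ∫ y : ℝ, (y : ℂ) * Complex.I * Complex.exp (-(y : ℂ) ^ 2 / 2) = 0 := by
      refine integral_eq_zero_of_hasDerivAt_of_integrable
        (f := fun y : ℝ => -Complex.I * Complex.exp (-(y : ℂ) ^ 2 / 2)) (fun y => ?_)
        hyg (hg.const_mul _)
      have h0 : HasDerivAt (fun y : ℝ => (y : ℂ)) 1 y := Complex.ofRealCLM.hasDerivAt
      refine (((h0.pow 2).neg.div_const 2).cexp.const_mul (-Complex.I)).congr_deriv ?_
      simp only [Pi.pow_apply, Pi.neg_apply]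
      push_cast
      ring
    simp only [pow_one, add_mul, hermite_one, aeval_X]
    rw [integral_add (hg.const_mul _) hyg, hodd, integral_const_mul,
      integral_cexp_neg_sq_div_two]
    ring
  | more n ih0 ih1 =>
    rw [integral_pow_mul_gaussian_add_two, ih0, ih1, hermite_add_two]
    simp only [map_sub, map_mul, aeval_X, map_natCast]
    push_cast
    ring

end HermiteIntegral

section MehlerKernel

theorem integrable_exp_mul_gaussian_prod {a : ℝ} (ha : |a| < 1) (w w' : ℝ) :
    Integrable (fun p : ℝ × ℝ =>
      Real.exp (‖(a : ℂ) * (w + p.1 * Complex.I) * (w' + p.2 * Complex.I)‖) *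
        (Real.exp (-p.1 ^ 2 / 2) * Real.exp (-p.2 ^ 2 / 2))) (volume.prod volume) := by
  set d : ℝ := (1 - |a|) / 4 with hd
  have hd0 : 0 < d := by rw [hd]; linarith
  have hg := integrable_exp_neg_mul_sq hd0
  refine ((hg.mul_prod hg).const_mul
    (Real.exp (|w| * |w'| + (w ^ 2 + w' ^ 2) / (4 * d)))).mono'
    (Continuous.aestronglyMeasurable (by fun_prop)) (.of_forall fun p => ?_)
  obtain ⟨y, z⟩ := p
  rw [Real.norm_of_nonneg (by positivity), ← Real.exp_add, ← Real.exp_add, ← Real.exp_add,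
    ← Real.exp_add, Real.exp_le_exp, norm_mul, norm_mul, Complex.norm_real, Real.norm_eq_abs]
  have young : ∀ s t : ℝ, |s| * |t| ≤ s ^ 2 / (4 * d) + d * t ^ 2 := by
    intro s t
    have : s ^ 2 / (4 * d) + d * t ^ 2 - |s| * |t| = (|s| - 2 * d * |t|) ^ 2 / (4 * d) := by
      rw [← sq_abs s, ← sq_abs t]
      field_simp
      ring
    have : 0 ≤ (|s| - 2 * d * |t|) ^ 2 / (4 * d) := by positivity
    linarith
  have hyz : |a| * (|y| * |z|) ≤ |a| * ((y ^ 2 + z ^ 2) / 2) := by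
    gcongr
    nlinarith [sq_nonneg (|y| - |z|), sq_abs y, sq_abs z]
  have hle : ∀ s : ℝ, 0 ≤ s → |a| * s ≤ s := fun s hs => mul_le_of_le_one_left hs ha.le
  calc |a| * ‖(w : ℂ) + y * Complex.I‖ * ‖(w' : ℂ) + z * Complex.I‖ + (-y ^ 2 / 2 + -z ^ 2 / 2)
      ≤ |a| * (|w| + |y|) * (|w'| + |z|) + (-y ^ 2 / 2 + -z ^ 2 / 2) := by
        gcongr <;> exact norm_ofReal_add_mul_I_le _ _
    _ = |a| * (|w| * |w'|) + |a| * (|w| * |z|) + |a| * (|w'| * |y|) + |a| * (|y| * |z|)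
          + (-y ^ 2 / 2 + -z ^ 2 / 2) := by ring
    _ ≤ |w| * |w'| + (w ^ 2 / (4 * d) + d * z ^ 2) + (w' ^ 2 / (4 * d) + d * y ^ 2)
          + |a| * ((y ^ 2 + z ^ 2) / 2) + (-y ^ 2 / 2 + -z ^ 2 / 2) := by
        linarith [hle (|w| * |w'|) (by positivity), hle (|w| * |z|) (by positivity),
          hle (|w'| * |y|) (by positivity), young w z, young w' y]
    _ = _ := by rw [add_div, show |a| = 1 - 4 * d by rw [hd]; ring]; ring

theorem integral_integral_mehler_kernel {a : ℝ} (ha : |a| < 1) (w w' : ℝ) :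
    ∫ y : ℝ, ∫ z : ℝ, Complex.exp ((a : ℂ) * (w + y * Complex.I) * (w' + z * Complex.I)) *
        (Complex.exp (-(y : ℂ) ^ 2 / 2) * Complex.exp (-(z : ℂ) ^ 2 / 2)) =
      ((2 * Real.pi / Real.sqrt (1 - a ^ 2) *
        Real.exp ((2 * a * w * w' - a ^ 2 * w ^ 2 - a ^ 2 * w' ^ 2) / (2 * (1 - a ^ 2))) : ℝ) :
          ℂ) := by
  have h1 : 0 < 1 - a ^ 2 := by nlinarith [sq_abs a, abs_nonneg a]
  have h1c : (1 - a ^ 2 : ℂ) ≠ 0 := by exact_mod_cast h1.ne'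
  have hsqrt : ∀ r : ℝ, 0 ≤ r → (r : ℂ) ^ (1 / 2 : ℂ) = (Real.sqrt r : ℂ) := by
    intro r hr
    rw [Real.sqrt_eq_rpow, Complex.ofReal_cpow hr]
    norm_num
  have inner : ∀ y : ℝ,
      ∫ z : ℝ, Complex.exp ((a : ℂ) * (w + y * Complex.I) * (w' + z * Complex.I)) *
        (Complex.exp (-(y : ℂ) ^ 2 / 2) * Complex.exp (-(z : ℂ) ^ 2 / 2)) =
      (Real.sqrt (2 * Real.pi) : ℂ) * Complex.exp ((((-(1 - a ^ 2) / 2 : ℝ)) : ℂ) * (y : ℂ) ^ 2 +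
        (a * w' - a ^ 2 * w) * Complex.I * y + (a * w * w' - a ^ 2 * w ^ 2 / 2)) := by
    intro y
    have h := integral_cexp_quadratic (b := ((-(1 / 2) : ℝ) : ℂ))
      (by rw [Complex.ofReal_re]; norm_num)
      ((a : ℂ) * (w + y * Complex.I) * Complex.I)
      ((a : ℂ) * (w + y * Complex.I) * w' - (y : ℂ) ^ 2 / 2)
    rw [show (Real.pi : ℂ) / -((-(1 / 2) : ℝ) : ℂ) = ((2 * Real.pi : ℝ) : ℂ) by
      push_cast; ring, hsqrt _ (by positivity)] at h
    convert h using 1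
    · congr 1 with z
      rw [← Complex.exp_add, ← Complex.exp_add]
      congr 1
      push_cast
      ring
    · congr 2
      push_cast
      have := Complex.I_sq
      have h4 : Complex.I ^ 4 = 1 := Complex.I_pow_four
      have h3 : Complex.I ^ 3 = -Complex.I := Complex.I_pow_three
      ring_nf
      simp only [this, h4, h3]
      ring
  simp_rw [inner]
  rw [integral_const_mul, integral_cexp_quadratic
    (by rw [Complex.ofReal_re]; linarith)]
  rw [show (Real.pi : ℂ) / -((-(1 - a ^ 2) / 2 : ℝ) : ℂ) =
    ((2 * Real.pi / (1 - a ^ 2) : ℝ) : ℂ) by push_cast; field_simp, hsqrt _ (by positivity),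
    ← mul_assoc, ← Complex.ofReal_mul, Real.sqrt_div (by positivity), ← mul_div_assoc,
    Real.mul_self_sqrt (by positivity), Complex.ofReal_mul, Complex.ofReal_exp]
  congr 2
  push_cast
  rw [mul_pow, Complex.I_sq]
  field_simp
  ring

end MehlerKernel

/-- Mehler's formula: for `|a| < 1`,
`p(w,w') = φ(w)φ(w') Σ_{n≥0} (aⁿ/n!) He_n(w) He_n(w')`. -/
theorem mehler_formula
    (a : ℝ) (ha : |a| < 1) (w w' : ℝ) :
    HasSum
      (fun n : ℕ => stdNormalPDF w * stdNormalPDF w' *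
        (a ^ n / (n.factorial : ℝ)) *
        ((Polynomial.hermite n).aeval w : ℝ) * ((Polynomial.hermite n).aeval w' : ℝ))
      (bivNormalPDF a w w') := by
  have h1 : 0 < 1 - a ^ 2 := by nlinarith [sq_abs a, abs_nonneg a]
  have hexp : ∀ s : ℝ, HasSum (fun n : ℕ => s ^ n / n.factorial) (Real.exp s) := fun s => by
    rw [Real.exp_eq_exp_ℝ]
    exact NormedSpace.expSeries_div_hasSum_exp s
  have hcexp : ∀ s : ℂ, HasSum (fun n : ℕ => s ^ n / n.factorial) (Complex.exp s) := fun s => by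
    rw [Complex.exp_eq_exp_ℂ]
    exact NormedSpace.expSeries_div_hasSum_exp s
  let T : ℝ × ℝ → ℂ := fun p => (a : ℂ) * (w + p.1 * Complex.I) * (w' + p.2 * Complex.I)
  let G : ℝ × ℝ → ℂ := fun p => Complex.exp (-(p.1 : ℂ) ^ 2 / 2) * Complex.exp (-(p.2 : ℂ) ^ 2 / 2)
  have hG : ∀ p, ‖G p‖ = Real.exp (-p.1 ^ 2 / 2) * Real.exp (-p.2 ^ 2 / 2) := fun p => by
    simp only [G, norm_mul, norm_cexp_neg_sq_div_two]
  have hint := integrable_exp_mul_gaussian_prod ha w w'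
  have hbound : ∀ p, HasSum (fun n : ℕ => ‖T p‖ ^ n / n.factorial * ‖G p‖)
      (Real.exp ‖T p‖ * ‖G p‖) := fun p => (hexp _).mul_right _
  have hkernel : Integrable (fun p => Complex.exp (T p) * G p) (volume.prod volume) := by
    refine hint.mono' (Continuous.aestronglyMeasurable (by fun_prop)) (.of_forall fun p => ?_)
    rw [norm_mul, hG]
    gcongr
    exact Complex.norm_exp_le_exp_norm _
  have hsum := hasSum_integral_of_dominated_convergence (μ := (volume.prod volume : Measure (ℝ × ℝ)))
    (F := fun (n : ℕ) p => T p ^ n / n.factorial * G p) (f := fun p => Complex.exp (T p) * G p)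
    (fun n p => ‖T p‖ ^ n / n.factorial * ‖G p‖)
    (fun n => Continuous.aestronglyMeasurable (by fun_prop))
    (fun n => .of_forall fun p => by simp)
    (.of_forall fun p => (hbound p).summable)
    (by simp only [fun p => (hbound p).tsum_eq]
        simpa only [hG] using hint)
    (.of_forall fun p => (hcexp _).mul_right _)
  have hterm : ∀ n : ℕ, ∫ p, T p ^ n / n.factorial * G p ∂(volume.prod volume) =
      ((2 * Real.pi * (a ^ n / n.factorial) * (Polynomial.hermite n).aeval w *
        (Polynomial.hermite n).aeval w' : ℝ) : ℂ) := by
    intro n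
    have hprod := integral_prod_mul (μ := (volume : Measure ℝ)) (ν := (volume : Measure ℝ))
      (fun y : ℝ => ((w : ℂ) + y * Complex.I) ^ n * Complex.exp (-(y : ℂ) ^ 2 / 2))
      (fun z : ℝ => ((w' : ℂ) + z * Complex.I) ^ n * Complex.exp (-(z : ℂ) ^ 2 / 2))
    rw [integral_pow_mul_gaussian, integral_pow_mul_gaussian] at hprod
    have hsq : (Real.sqrt (2 * Real.pi) : ℂ) * Real.sqrt (2 * Real.pi) = 2 * Real.pi := by
      rw [← Complex.ofReal_mul, Real.mul_self_sqrt (by positivity)]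
      push_cast
      rfl
    calc _ = ∫ p : ℝ × ℝ, ((a : ℂ) ^ n / n.factorial) *
          ((((w : ℂ) + p.1 * Complex.I) ^ n * Complex.exp (-(p.1 : ℂ) ^ 2 / 2)) *
          (((w' : ℂ) + p.2 * Complex.I) ^ n * Complex.exp (-(p.2 : ℂ) ^ 2 / 2)))
          ∂(volume.prod volume) := by
          congr 1 with p
          simp only [T, G, mul_pow]
          ring
      _ = _ := by
          rw [integral_const_mul, hprod]
          push_cast
          linear_combination ((a : ℂ) ^ n / n.factorial *
            ((Polynomial.hermite n).aeval w : ℝ) * ((Polynomial.hermite n).aeval w' : ℝ)) * hsq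
  simp only [hterm] at hsum
  rw [integral_prod _ hkernel, integral_integral_mehler_kernel ha, Complex.hasSum_ofReal] at hsum
  have hpref : stdNormalPDF w * stdNormalPDF w' =
      (2 * Real.pi)⁻¹ * Real.exp (-(w ^ 2) / 2 + -(w' ^ 2) / 2) := by
    rw [stdNormalPDF, stdNormalPDF, Real.exp_add, mul_mul_mul_comm, ← mul_inv,
      Real.mul_self_sqrt (by positivity)]
  have hval : bivNormalPDF a w w' = (2 * Real.pi)⁻¹ * (stdNormalPDF w * stdNormalPDF w') *
      (2 * Real.pi / √(1 - a ^ 2) *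
        Real.exp ((2 * a * w * w' - a ^ 2 * w ^ 2 - a ^ 2 * w' ^ 2) / (2 * (1 - a ^ 2)))) := by
    rw [hpref, bivNormalPDF, show -(w ^ 2 - 2 * a * w * w' + w' ^ 2) / (2 * (1 - a ^ 2)) =
      (-(w ^ 2) / 2 + -(w' ^ 2) / 2) +
        (2 * a * w * w' - a ^ 2 * w ^ 2 - a ^ 2 * w' ^ 2) / (2 * (1 - a ^ 2)) by
      field_simp; ring, Real.exp_add]
    field_simp
  rw [hval]
  refine (congrArg (HasSum · _) (funext fun n => ?_)).mpr (hsum.mul_left _)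
  field_simp
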